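/- arXiv:1305.6653 — 5 statements merged into one kernel-verified Lean document; each statement's English description precedes it below -/
import Mathlib

section
/- For every real number α with 1 < α < 2 and every integer n ≥ 1, the partial sum omitting the index k = 1 satisfies ∑_{k=0, k≠1}^{n} g_k^(α) < α = -g_1^(α). -/
/-- The alternating fractional binomial coefficient
`g_k^(α) = (-1)^k (α choose k) = ((-1)^k / k!) · α(α-1)⋯(α-k+1)`. -/
noncomputable def g (α : ℝ) (k : ℕ) : ℝ :=
  (-1 : ℝ) ^ k * (∏ i ∈ Finset.range k, (α - i)) / (Nat.factorial k)

theorem g_succ (α : ℝ) (k : ℕ) : g α (k + 1) = g α k * ((k - α) / (k + 1)) := by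
  unfold g
  rw [Finset.prod_range_succ, Nat.factorial_succ, pow_succ]
  push_cast
  field_simp
  ring

theorem g_succ_eq_sub_one (α : ℝ) (k : ℕ) : g α (k + 1) = -(α / (k + 1)) * g (α - 1) k := by
  have h : ∏ i ∈ Finset.range (k + 1), (α - i) = (∏ i ∈ Finset.range k, (α - 1 - i)) * α := by
    rw [Finset.prod_range_succ']
    congr 1
    · refine Finset.prod_congr rfl fun i _ => ?_
      push_cast
      ring
    · simp
  unfold g
  rw [h, Nat.factorial_succ, pow_succ]
  push_cast
  field_simp

theorem sum_range_succ_g (α : ℝ) (n : ℕ) :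
    ∑ k ∈ Finset.range (n + 1), g α k = g (α - 1) n := by
  induction n with
  | zero => simp [g]
  | succ n ih =>
    rw [Finset.sum_range_succ, ih, g_succ_eq_sub_one, g_succ (α - 1)]
    field_simp
    ring

theorem g_neg_of_lt_one {β : ℝ} (h0 : 0 < β) (h1 : β < 1) {n : ℕ} (hn : 1 ≤ n) : g β n < 0 := by
  induction n, hn using Nat.le_induction with
  | base => simpa [g] using h0
  | succ n hn ih =>
    rw [g_succ]
    have hn' : (1 : ℝ) ≤ n := by exact_mod_cast hn
    exact mul_neg_of_neg_of_pos ih (div_pos (by linarith) (by linarith))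

/-- For `1 < α < 2` and every `n ≥ 1`, the partial sum omitting the index `k = 1`
satisfies `∑_{k=0, k≠1}^{n} g_k^(α) < α = -g_1^(α)`. -/
theorem stmt4 (α : ℝ) (hα1 : 1 < α) (hα2 : α < 2) (n : ℕ) (hn : 1 ≤ n) :
    (∑ k ∈ (Finset.range (n + 1)).erase 1, g α k < α) ∧ α = -(g α 1) := by
  have hg : α = -(g α 1) := by simp [g]
  refine ⟨?_, hg⟩
  have hsum := Finset.add_sum_erase (Finset.range (n + 1)) (g α)
    (Finset.mem_range.mpr (by omega : 1 < n + 1))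
  rw [sum_range_succ_g] at hsum
  have hneg : g (α - 1) n < 0 := g_neg_of_lt_one (by linarith) (by linarith) hn
  linarith
end

section
/- Assume in addition that d_{+,i} + d_{-,i} ≠ 0 for every i. Then every (complex) eigenvalue λ of J_N has strictly negative real part: Re(λ) < 0. -/
open Matrix

/-- The `N×N` lower-Hessenberg Toeplitz matrix `G_α` with
`(G_α)_{i,j} = g_{i-j+1}^(α)` for `i - j ≥ -1` and `0` otherwise. -/
noncomputable def Gmat (α : ℝ) (N : ℕ) : Matrix (Fin N) (Fin N) ℝ :=
  Matrix.of fun i j => if (j : ℕ) ≤ (i : ℕ) + 1 then g α ((i : ℕ) + 1 - (j : ℕ)) else 0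

/-- The semi-discretization matrix `J_N = (1/Δx^α)(D₊ G_α + D₋ G_αᵀ)`. -/
noncomputable def Jmat (α : ℝ) (N : ℕ) (Δx : ℝ) (dp dm : Fin N → ℝ) :
    Matrix (Fin N) (Fin N) ℝ :=
  (Δx ^ α)⁻¹ • (Matrix.diagonal dp * Gmat α N + Matrix.diagonal dm * (Gmat α N)ᵀ)

theorem g_zero (α : ℝ) : g α 0 = 1 := by simp [g]

theorem g_one (α : ℝ) : g α 1 = -α := by simp [g]

theorem g_succ_mul (α : ℝ) (k : ℕ) : g α (k + 1) * (k + 1) = g α k * (k - α) := by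
  have h : (Nat.factorial k : ℝ) ≠ 0 := by exact_mod_cast k.factorial_ne_zero
  have h' : (k : ℝ) + 1 ≠ 0 := by positivity
  simp only [g, Finset.prod_range_succ, Nat.factorial_succ]
  push_cast
  field_simp
  ring

/-- Each coefficient is a multiple of the preceding partial sum. -/
theorem g_succ_mul_eq_sum (α : ℝ) (n : ℕ) :
    g α (n + 1) * (n + 1) = -α * ∑ k ∈ Finset.range (n + 1), g α k := by
  induction n with
  | zero => simp [g_zero, g_one]
  | succ n ih =>
    have h := g_succ_mul α (n + 1)
    rw [h, Finset.sum_range_succ, mul_add, ← ih]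
    push_cast
    ring

theorem sum_range_g_neg {α : ℝ} (hα1 : 1 < α) (hα2 : α < 2) (n : ℕ) :
    ∑ k ∈ Finset.range (n + 2), g α k < 0 := by
  induction n with
  | zero => simp [Finset.sum_range_succ, g_zero, g_one, hα1]
  | succ n ih =>
    have h := g_succ_mul_eq_sum α (n + 1)
    have hn : (0 : ℝ) ≤ n := n.cast_nonneg
    rw [Finset.sum_range_succ]
    push_cast at h
    nlinarith

theorem g_nonneg {α : ℝ} (hα1 : 1 < α) (hα2 : α < 2) {k : ℕ} (hk : k ≠ 1) : 0 ≤ g α k := by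
  match k, hk with
  | 0, _ => simp [g_zero]
  | n + 2, _ =>
    have h := g_succ_mul_eq_sum α (n + 1)
    have hS := sum_range_g_neg hα1 hα2 n
    have hn : (0 : ℝ) ≤ n := n.cast_nonneg
    push_cast at h
    by_contra! hneg
    nlinarith

theorem sum_g_neg {α : ℝ} (hα1 : 1 < α) (hα2 : α < 2) {s : Finset ℕ} (hs : 1 ∈ s) :
    ∑ k ∈ s, g α k < 0 := by
  refine lt_of_le_of_lt (Finset.sum_le_sum_of_subset_of_nonneg (t := Finset.range (s.sup id + 2))
    (fun k hk => ?_) fun k _ hk => g_nonneg hα1 hα2 ?_) (sum_range_g_neg hα1 hα2 (s.sup id))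
  · have := Finset.le_sup (f := id) hk
    simp only [id] at this
    exact Finset.mem_range.2 (by omega)
  · rintro rfl
    exact hk hs

theorem Gmat_nonneg {α : ℝ} (hα1 : 1 < α) (hα2 : α < 2) {N : ℕ} {i j : Fin N} (h : i ≠ j) :
    0 ≤ Gmat α N i j := by
  have h' : (i : ℕ) ≠ j := fun e => h (Fin.ext e)
  simp only [Gmat, Matrix.of_apply]
  split_ifs
  · exact g_nonneg hα1 hα2 (by omega)
  · exact le_rfl

theorem sum_Gmat_row_neg {α : ℝ} (hα1 : 1 < α) (hα2 : α < 2) {N : ℕ} (i : Fin N) :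
    ∑ j, Gmat α N i j < 0 := by
  simp only [Gmat, Matrix.of_apply]
  rw [← Finset.sum_filter, ← Finset.sum_image (f := g α) (g := fun j : Fin N => (i : ℕ) + 1 - j)]
  · exact sum_g_neg hα1 hα2 (Finset.mem_image.2 ⟨i, by simp, by simp⟩)
  · intro a ha b hb hab
    simp only [Finset.coe_filter, Finset.mem_univ, true_and, Set.mem_ofPred_eq] at ha hb hab
    exact Fin.ext (by omega)

theorem sum_Gmat_col_neg {α : ℝ} (hα1 : 1 < α) (hα2 : α < 2) {N : ℕ} (j : Fin N) :
    ∑ i, Gmat α N i j < 0 := by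
  simp only [Gmat, Matrix.of_apply]
  rw [← Finset.sum_filter, ← Finset.sum_image (f := g α) (g := fun i : Fin N => (i : ℕ) + 1 - j)]
  · exact sum_g_neg hα1 hα2 (Finset.mem_image.2 ⟨j, by simp, by simp⟩)
  · intro a ha b hb hab
    simp only [Finset.coe_filter, Finset.mem_univ, true_and, Set.mem_ofPred_eq] at ha hb hab
    exact Fin.ext (by omega)

/-- By Gershgorin's theorem, a real matrix with nonnegative off-diagonal entries and negative row
sums has its spectrum in the open left half-plane. -/
theorem re_neg_of_mem_spectrum_of_sum_row_neg {n : Type*} [Fintype n] [DecidableEq n]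
    {A : Matrix n n ℝ} (hoff : ∀ i j, i ≠ j → 0 ≤ A i j) (hrow : ∀ i, ∑ j, A i j < 0)
    {z : ℂ} (hz : z ∈ spectrum ℂ (A.map Complex.ofReal)) : z.re < 0 := by
  rw [← Matrix.spectrum_toLin', ← Module.End.hasEigenvalue_iff_mem_spectrum] at hz
  obtain ⟨k, hk⟩ := eigenvalue_mem_ball hz
  have hsum : ∑ j ∈ Finset.univ.erase k, ‖A.map Complex.ofReal k j‖
      = ∑ j ∈ Finset.univ.erase k, A k j :=
    Finset.sum_congr rfl fun j hj => by
      simp [abs_of_nonneg (hoff k j (Finset.ne_of_mem_erase hj).symm)]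
  rw [hsum, mem_closedBall_iff_norm] at hk
  have hre := (Complex.re_le_norm _).trans hk
  rw [Complex.sub_re, Matrix.map_apply, Complex.ofReal_re] at hre
  have := Finset.add_sum_erase Finset.univ (A k) (Finset.mem_univ k)
  linarith [hrow k]

theorem Jmat_apply (α : ℝ) (N : ℕ) (Δx : ℝ) (dp dm : Fin N → ℝ) (i j : Fin N) :
    Jmat α N Δx dp dm i j = (Δx ^ α)⁻¹ * (dp i * Gmat α N i j + dm i * Gmat α N j i) := by
  simp [Jmat, Matrix.diagonal_mul]

/-- If `d_{+,i} + d_{-,i} ≠ 0` for every `i`, then every (complex) eigenvalue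
`λ` of `J_N` has strictly negative real part. -/
theorem stmt8 (α : ℝ) (hα1 : 1 < α) (hα2 : α < 2) (N : ℕ) (hN : 1 ≤ N)
    (Δx : ℝ) (hΔx : 0 < Δx) (dp dm : Fin N → ℝ)
    (hdp : ∀ i, 0 ≤ dp i) (hdm : ∀ i, 0 ≤ dm i)
    (hdpm : ∀ i, dp i + dm i ≠ 0) :
    ∀ z ∈ spectrum ℂ ((Jmat α N Δx dp dm).map (Complex.ofReal)), z.re < 0 := by
  have hr : 0 < (Δx ^ α)⁻¹ := inv_pos.2 (Real.rpow_pos_of_pos hΔx α)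
  intro z hz
  refine re_neg_of_mem_spectrum_of_sum_row_neg (fun i j hij => ?_) (fun i => ?_) hz
  · rw [Jmat_apply]
    exact mul_nonneg hr.le (add_nonneg (mul_nonneg (hdp i) (Gmat_nonneg hα1 hα2 hij))
      (mul_nonneg (hdm i) (Gmat_nonneg hα1 hα2 hij.symm)))
  · simp only [Jmat_apply]
    rw [← Finset.mul_sum, Finset.sum_add_distrib, ← Finset.mul_sum, ← Finset.mul_sum]
    refine mul_neg_of_pos_of_neg hr ?_
    have hR := sum_Gmat_row_neg hα1 hα2 i
    have hC := sum_Gmat_col_neg hα1 hα2 i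
    rcases (hdp i).lt_or_eq with h | h
    · exact add_neg_of_neg_of_nonpos (mul_neg_of_pos_of_neg h hR)
        (mul_nonpos_of_nonneg_of_nonpos (hdm i) hC.le)
    · have hm : 0 < dm i := lt_of_le_of_ne (hdm i) fun e => hdpm i (by rw [← h, ← e, add_zero])
      rw [← h, zero_mul, zero_add]
      exact mul_neg_of_pos_of_neg hm hC
end

section
/- Let s ≥ 0 and N ≥ 1 be integers, h ∈ ℂ, and let C_A and C_B be (s+1)×(s+1) complex circulant matrices with first columns a = (a_0,…,a_s) and b = (b_0,…,b_s), and let C_J be an N×N complex circulant matrix with first column c = (c_0,…,c_{N-1}). Set ω = e^{2πi/(s+1)} and ζ = e^{2πi/N}. Then the spectrum of the (s+1)N × (s+1)N matrix C_A ⊗ I_N − h · C_B ⊗ C_J is exactly the set { φ_j − h ψ_j λ_k : 0 ≤ j ≤ s, 0 ≤ k ≤ N−1 }, where φ_j = ∑_{r=0}^{s} a_r ω^{rj}, ψ_j = ∑_{r=0}^{s} b_r ω^{rj}, and λ_k = ∑_{l=0}^{N−1} c_l ζ^{lk}. -/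
open Matrix Kronecker Complex Real

/-- The discrete Fourier matrix intertwines a circulant matrix and the diagonal matrix of its
eigenvalues. -/
theorem vandermonde_mul_circulant {R : Type*} [CommRing R] {n : ℕ} [NeZero n] {w : R}
    (hw : w ^ n = 1) (v : Fin n → R) :
    vandermonde (fun j : Fin n => w ^ (j : ℕ)) * circulant v =
      diagonal (fun j : Fin n => ∑ r : Fin n, v r * w ^ ((r : ℕ) * (j : ℕ))) *
        vandermonde (fun j : Fin n => w ^ (j : ℕ)) := by
  ext j i
  have hj : (w ^ (j : ℕ)) ^ n = 1 := by rw [← pow_mul, mul_comm, pow_mul, hw, one_pow]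
  rw [diagonal_mul, mul_apply, ← Equiv.sum_comp (Equiv.addRight i), Finset.sum_mul]
  refine Finset.sum_congr rfl fun r _ => ?_
  rw [vandermonde_apply, vandermonde_apply, circulant_apply, Equiv.coe_addRight,
    add_sub_cancel_right, Fin.val_add, ← pow_eq_pow_mod _ hj, pow_add, mul_comm (r : ℕ), pow_mul]
  ring

theorem isUnit_vandermonde_of_isPrimitiveRoot {K : Type*} [Field K] {n : ℕ} {w : K}
    (hw : IsPrimitiveRoot w n) : IsUnit (vandermonde fun j : Fin n => w ^ (j : ℕ)) := by
  rw [isUnit_iff_isUnit_det, isUnit_iff_ne_zero, det_vandermonde_ne_zero_iff]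
  exact fun i j hij => Fin.ext (hw.pow_inj i.2 j.2 hij)

/-- The spectrum of a matrix which an invertible matrix intertwines with a diagonal one. -/
theorem spectrum_eq_range_of_mul_eq_diagonal_mul {K ι : Type*} [Field K] [Fintype ι]
    [DecidableEq ι] {P M : Matrix ι ι K} {d : ι → K} (hP : IsUnit P)
    (hM : P * M = diagonal d * P) : spectrum K M = Set.range d := by
  obtain ⟨u, rfl⟩ := hP
  rw [← spectrum.units_conjugate (u := u), hM, mul_assoc, Units.mul_inv, mul_one,
    spectrum_diagonal]

/-- The spectrum of `C_A ⊗ I_N − h · C_B ⊗ C_J`, for circulants `C_A`, `C_B`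
of order `s+1` with first columns `a`, `b` and a circulant `C_J` of order `N`
with first column `c`, is exactly `{ φ_j − h ψ_j λ_k }`, where
`φ_j = ∑ a_r ω^{rj}`, `ψ_j = ∑ b_r ω^{rj}`, `λ_k = ∑ c_l ζ^{lk}`,
with `ω = e^{2πi/(s+1)}` and `ζ = e^{2πi/N}`. -/
theorem stmt13 (s N : ℕ) (hN : 1 ≤ N) (h : ℂ)
    (a b : Fin (s + 1) → ℂ) (c : Fin N → ℂ)
    (ω ζ : ℂ) (hω : ω = Complex.exp (2 * Real.pi * Complex.I / (s + 1)))
    (hζ : ζ = Complex.exp (2 * Real.pi * Complex.I / N))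
    (φ ψ : Fin (s + 1) → ℂ) (lam : Fin N → ℂ)
    (hφ : ∀ j, φ j = ∑ r : Fin (s + 1), a r * ω ^ ((r : ℕ) * (j : ℕ)))
    (hψ : ∀ j, ψ j = ∑ r : Fin (s + 1), b r * ω ^ ((r : ℕ) * (j : ℕ)))
    (hlam : ∀ k, lam k = ∑ l : Fin N, c l * ζ ^ ((l : ℕ) * (k : ℕ))) :
    spectrum ℂ
        (Matrix.circulant a ⊗ₖ (1 : Matrix (Fin N) (Fin N) ℂ) -
          h • (Matrix.circulant b ⊗ₖ Matrix.circulant c)) =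
      { z : ℂ | ∃ (j : Fin (s + 1)) (k : Fin N), z = φ j - h * ψ j * lam k } := by
  have : NeZero N := ⟨by omega⟩
  have hω' : IsPrimitiveRoot ω (s + 1) := by
    simpa [hω] using Complex.isPrimitiveRoot_exp (s + 1) s.succ_ne_zero
  have hζ' : IsPrimitiveRoot ζ N := hζ ▸ Complex.isPrimitiveRoot_exp N (NeZero.ne N)
  set V := vandermonde fun j : Fin (s + 1) => ω ^ (j : ℕ)
  set W := vandermonde fun k : Fin N => ζ ^ (k : ℕ)
  have hA : V * circulant a = diagonal φ * V :=
    funext hφ ▸ vandermonde_mul_circulant hω'.pow_eq_one a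
  have hB : V * circulant b = diagonal ψ * V :=
    funext hψ ▸ vandermonde_mul_circulant hω'.pow_eq_one b
  have hC : W * circulant c = diagonal lam * W :=
    funext hlam ▸ vandermonde_mul_circulant hζ'.pow_eq_one c
  have hVW : IsUnit (V ⊗ₖ W) := by
    have hV := isUnit_vandermonde_of_isPrimitiveRoot hω'
    have hW := isUnit_vandermonde_of_isPrimitiveRoot hζ'
    rw [isUnit_iff_isUnit_det] at hV hW ⊢
    rw [det_kronecker]
    exact (hV.pow _).mul (hW.pow _)
  have hd : diagonal (fun p : Fin (s + 1) × Fin N => φ p.1 - h * ψ p.1 * lam p.2) =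
      diagonal φ ⊗ₖ (1 : Matrix (Fin N) (Fin N) ℂ) - h • (diagonal ψ ⊗ₖ diagonal lam) := by
    rw [← diagonal_one, diagonal_kronecker_diagonal, diagonal_kronecker_diagonal,
      ← diagonal_smul, diagonal_sub]
    simp [mul_assoc]
  rw [spectrum_eq_range_of_mul_eq_diagonal_mul hVW
    (d := fun p => φ p.1 - h * ψ p.1 * lam p.2)]
  · ext z
    simp [eq_comm]
  · rw [hd, mul_sub, sub_mul, mul_smul_comm, smul_mul_assoc, ← mul_kronecker_mul,
      ← mul_kronecker_mul, ← mul_kronecker_mul, ← mul_kronecker_mul, hA, hB, hC, mul_one, one_mul]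
end

section
/- (Theorem 3.3, algebraic form) Let s ≥ 0, N ≥ 1, μ ≥ 1 be integers with 2μ ≤ s+1, let h ∈ ℂ, let A, Â, B, B̂ be (s+1)×(s+1) complex matrices such that A − Â and B − B̂ have nonzero entries only in their first μ rows and their last μ rows, and let J be an N×N complex matrix. Set M = A ⊗ I_N − h B ⊗ J and S = Â ⊗ I_N − h B̂ ⊗ J, and assume S is invertible. Then S^{-1} M = I + L, where I is the (s+1)N × (s+1)N identity matrix and L is a matrix of rank at most 2μN. -/
open Matrix Kronecker

/-- (Theorem 3.3, algebraic form) If `A − Â` and `B − B̂` have nonzero entries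
only in their first `μ` and last `μ` rows (with `2μ ≤ s+1`), if
`M = A ⊗ I_N − h B ⊗ J` and `S = Â ⊗ I_N − h B̂ ⊗ J` with `S` invertible,
then `S⁻¹ M = I + L` where `L` has rank at most `2μN`. -/
theorem stmt15 (s N μ : ℕ) (hN : 1 ≤ N) (hμ : 1 ≤ μ) (hμs : 2 * μ ≤ s + 1)
    (h : ℂ) (A Ahat B Bhat : Matrix (Fin (s + 1)) (Fin (s + 1)) ℂ)
    (J : Matrix (Fin N) (Fin N) ℂ)
    (hA : ∀ i j : Fin (s + 1), μ ≤ (i : ℕ) → (i : ℕ) < s + 1 - μ →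
      (A - Ahat) i j = 0)
    (hB : ∀ i j : Fin (s + 1), μ ≤ (i : ℕ) → (i : ℕ) < s + 1 - μ →
      (B - Bhat) i j = 0)
    (M S : Matrix (Fin (s + 1) × Fin N) (Fin (s + 1) × Fin N) ℂ)
    (hM : M = A ⊗ₖ (1 : Matrix (Fin N) (Fin N) ℂ) - h • (B ⊗ₖ J))
    (hS : S = Ahat ⊗ₖ (1 : Matrix (Fin N) (Fin N) ℂ) - h • (Bhat ⊗ₖ J))
    (hSinv : IsUnit S) :
    ∃ L : Matrix (Fin (s + 1) × Fin N) (Fin (s + 1) × Fin N) ℂ,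
      S⁻¹ * M = 1 + L ∧ L.rank ≤ 2 * μ * N := by
  have hdet : IsUnit S.det := (Matrix.isUnit_iff_isUnit_det S).mp hSinv
  refine ⟨S⁻¹ * (M - S), ?_, (rank_mul_le_right _ _).trans ?_⟩
  · rw [Matrix.mul_sub, nonsing_inv_mul S hdet, add_sub_cancel]
  let T : Finset (Fin (s + 1)) :=
    Finset.univ.filter fun i => ¬ (μ ≤ (i : ℕ) ∧ (i : ℕ) < s + 1 - μ)
  have hT : T.card ≤ 2 * μ := by
    have hsub : T.map Fin.valEmbedding ⊆ Finset.range μ ∪ Finset.Ico (s + 1 - μ) (s + 1) := by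
      intro k hk
      simp only [T, Finset.mem_map, Finset.mem_filter, Finset.mem_univ, true_and,
        Fin.valEmbedding_apply] at hk
      obtain ⟨i, hi, rfl⟩ := hk
      have := i.isLt
      simp only [Finset.mem_union, Finset.mem_range, Finset.mem_Ico]
      omega
    have hcard := (Finset.card_le_card hsub).trans (Finset.card_union_le _ _)
    rw [Finset.card_map, Finset.card_range, Nat.card_Ico] at hcard
    omega
  calc (M - S).rank ≤ (T ×ˢ (Finset.univ : Finset (Fin N))).card := by
        refine rank_le_card_of_support_subset _ _ ?_
        rintro ⟨i, k⟩ hik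
        by_contra hmem
        have hi : μ ≤ (i : ℕ) ∧ (i : ℕ) < s + 1 - μ := by
          by_contra hi
          exact hmem (by simpa [T] using hi)
        refine hik (funext fun ⟨j, l⟩ => ?_)
        have hAij : A i j = Ahat i j := sub_eq_zero.mp (hA i j hi.1 hi.2)
        have hBij : B i j = Bhat i j := sub_eq_zero.mp (hB i j hi.1 hi.2)
        simp [hM, hS, hAij, hBij]
    _ ≤ 2 * μ * N := by
        rw [Finset.card_product, Finset.card_univ, Fintype.card_fin]
        exact Nat.mul_le_mul_right N hT
end

section
/- (Theorem 3.1, invertibility of the Strang-type block-circulant preconditioner) Let μ ≥ 1, 0 ≤ ν ≤ μ, and s ≥ μ be integers, let α_0,…,α_μ and β_0,…,β_μ be real numbers, and define the characteristic polynomials ρ(z) = ∑_{j=0}^{μ} α_j z^j and σ(z) = ∑_{j=0}^{μ} β_j z^j. Let s(A) be the (s+1)×(s+1) circulant matrix with first column having entry α_{ν−r mod (μ+1)} appropriately placed, namely the circulant whose first column c satisfies c_0 = α_ν, c_r = α_{ν−r} for 1 ≤ r ≤ ν, c_{s+1−r} = α_{ν+r} for 1 ≤ r ≤ μ−ν, and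 c_r = 0 otherwise; let s(B) be defined in the same way from β_0,…,β_μ. Let J be an N×N complex matrix and h > 0, and set S = s(A) ⊗ I_N − h s(B) ⊗ J. If for every eigenvalue λ of J and every complex number z with z^{s+1} = 1 one has ρ(z) − hλ σ(z) ≠ 0, then S is invertible. -/
open Matrix Kronecker

/-- First column of the Strang-type circulant `s(A)` of order `s+1` built from
LMF coefficients `a_0, …, a_μ` with `ν` initial conditions:
`c_0 = a_ν`, `c_r = a_{ν−r}` for `1 ≤ r ≤ ν`, `c_{s+1−r} = a_{ν+r}` for
`1 ≤ r ≤ μ−ν`, and `c_r = 0` otherwise. -/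
def strangCol (a : ℕ → ℝ) (μ ν s : ℕ) : Fin (s + 1) → ℝ := fun r =>
  if (r : ℕ) = 0 then a ν
  else if (r : ℕ) ≤ ν then a (ν - (r : ℕ))
  else if s + 1 - (μ - ν) ≤ (r : ℕ) then a (ν + (s + 1 - (r : ℕ)))
  else 0

/-- A circulant matrix acts on a discrete Fourier transform through the transform of its first
column. -/
theorem sum_pow_mul_circulant_kronecker_mulVec {s N : ℕ} {z : ℂ} (hz : z ^ (s + 1) = 1)
    (c : Fin (s + 1) → ℂ) (M : Matrix (Fin N) (Fin N) ℂ) (x : Fin (s + 1) × Fin N → ℂ)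
    (k : Fin N) :
    ∑ i : Fin (s + 1), z ^ (i : ℕ) * ((circulant c ⊗ₖ M) *ᵥ x) (i, k) =
      (∑ r : Fin (s + 1), c r * z ^ (r : ℕ)) *
        (M *ᵥ fun l => ∑ j : Fin (s + 1), x (j, l) * z ^ (j : ℕ)) k := by
  have hpow (i j : Fin (s + 1)) :
      z ^ ((i + j : Fin (s + 1)) : ℕ) = z ^ (i : ℕ) * z ^ (j : ℕ) := by
    rw [Fin.val_add, ← pow_eq_pow_mod _ hz, pow_add]
  have hshift (j : Fin (s + 1)) :
      ∑ i : Fin (s + 1), z ^ (i : ℕ) * c (i - j) =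
        (∑ r : Fin (s + 1), c r * z ^ (r : ℕ)) * z ^ (j : ℕ) := by
    rw [← Equiv.sum_comp (Equiv.addRight j), Finset.sum_mul]
    refine Finset.sum_congr rfl fun r _ => ?_
    simp only [Equiv.coe_addRight, add_sub_cancel_right, hpow]
    ring
  simp only [mulVec, dotProduct, kroneckerMap_apply, circulant_apply, Fintype.sum_prod_type,
    Finset.mul_sum]
  rw [Finset.sum_comm]
  conv_rhs => rw [Finset.sum_comm]
  refine Finset.sum_congr rfl fun j _ => ?_
  rw [Finset.sum_comm]
  refine Finset.sum_congr rfl fun l _ => ?_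
  have h := congrArg (· * (M k l * x (j, l))) (hshift j)
  simp only [Finset.sum_mul] at h ⊢
  convert h using 2 <;> ring

/-- The symbol of the Strang circulant at a root of unity. -/
theorem sum_strangCol_mul_pow {μ ν s : ℕ} (hν : ν ≤ μ) (hs : μ ≤ s) (a : ℕ → ℝ) {z w : ℂ}
    (hz : z ^ (s + 1) = 1) (hzw : z * w = 1) :
    ∑ r : Fin (s + 1), (strangCol a μ ν s r : ℂ) * z ^ (r : ℕ) =
      z ^ ν * ∑ j ∈ Finset.range (μ + 1), (a j : ℂ) * w ^ j := by
  have hpow (m j : ℕ) : z ^ (m + j) * w ^ j = z ^ m := by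
    rw [pow_add, mul_assoc, ← mul_pow, hzw, one_pow, mul_one]
  rw [Finset.mul_sum]
  symm
  refine Finset.sum_of_injOn
    (fun j => Fin.ofNat (s + 1) (if j ≤ ν then ν - j else s + 1 + ν - j)) ?_ (by simp) ?_ ?_
  · intro i hi j hj hij
    simp only [Finset.coe_range, Set.mem_Iio] at hi hj
    simp only [Fin.ofNat, Fin.mk.injEq] at hij
    rw [Nat.mod_eq_of_lt (by split_ifs <;> omega),
      Nat.mod_eq_of_lt (by split_ifs <;> omega)] at hij
    split_ifs at hij <;> omega
  · intro r _ hr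
    have hval (j : ℕ) (hj : j < μ + 1)
        (h : (if j ≤ ν then ν - j else s + 1 + ν - j) = (r : ℕ)) : False := by
      refine hr ⟨j, by simpa using hj, Fin.ext ?_⟩
      simp only [Fin.ofNat, h]
      exact Nat.mod_eq_of_lt r.isLt
    have hcol : strangCol a μ ν s r = 0 := by
      unfold strangCol
      have hr' := r.isLt
      split_ifs with h₀ h₁ h₂
      · exact (hval ν (by omega) (by simp [h₀])).elim
      · exact (hval (ν - r) (by omega) (by rw [if_pos (by omega)]; omega)).elim
      · exact (hval (ν + (s + 1 - r)) (by omega) (by rw [if_neg (by omega)]; omega)).elim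
      · rfl
    simp [hcol]
  · intro j hj
    rw [Finset.mem_range] at hj
    have hlt : (if j ≤ ν then ν - j else s + 1 + ν - j) < s + 1 := by split_ifs <;> omega
    simp only [strangCol, Fin.ofNat, Nat.mod_eq_of_lt hlt]
    by_cases h : j ≤ ν
    · have hz' : z ^ ν * w ^ j = z ^ (ν - j) := by
        rw [← hpow (ν - j) j, Nat.sub_add_cancel h]
      simp only [if_pos h]
      rw [mul_left_comm, hz']
      split_ifs <;> first | omega | (congr 3; omega)
    · have hz' : z ^ ν * w ^ j = z ^ (s + 1 + ν - j) := by
        rw [← hpow (s + 1 + ν - j) j, Nat.sub_add_cancel (by omega), pow_add, hz, one_mul]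
      simp only [if_neg h]
      rw [mul_left_comm, hz']
      split_ifs <;> first | omega | (congr 3; omega)

/-- If no eigenvalue `l` of `J` solves `p = l * q`, then `p - q J` has trivial kernel. -/
theorem eq_zero_of_smul_eq_smul_mulVec {N : ℕ} {J : Matrix (Fin N) (Fin N) ℂ} {p q : ℂ}
    (h : ∀ l ∈ spectrum ℂ J, p - l * q ≠ 0) {y : Fin N → ℂ} (hy : p • y = q • (J *ᵥ y)) :
    y = 0 := by
  by_contra hy0
  obtain ⟨k, -⟩ := Function.ne_iff.mp hy0
  have : Nonempty (Fin N) := ⟨k⟩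
  by_cases hq : q = 0
  · obtain ⟨l, hl⟩ := spectrum.nonempty_of_isAlgClosed_of_finiteDimensional ℂ J
    have hp := h l hl
    simp_all
  · have hl : p / q ∈ spectrum ℂ J := by
      rw [← Matrix.spectrum_toLin', ← Module.End.hasEigenvalue_iff_mem_spectrum]
      refine Module.End.hasEigenvalue_of_hasEigenvector (x := y)
        ⟨Module.End.mem_eigenspace_iff.mpr ?_, hy0⟩
      rw [toLin'_apply, div_eq_inv_mul, mul_smul, hy, inv_smul_smul₀ hq]
    exact h _ hl (by field_simp; simp)

/-- A vector is zero when its discrete Fourier transform vanishes. -/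
theorem eq_zero_of_sum_mul_pow_eq_zero {s : ℕ} (v : Fin (s + 1) → ℂ)
    (h : ∀ z : ℂ, z ^ (s + 1) = 1 → ∑ j : Fin (s + 1), v j * z ^ (j : ℕ) = 0) : v = 0 := by
  have hζ := Complex.isPrimitiveRoot_exp (s + 1) s.succ_ne_zero
  set ζ := Complex.exp (2 * Real.pi * Complex.I / (s + 1 : ℕ))
  refine eq_zero_of_forall_index_sum_mul_pow_eq_zero (f := fun i : Fin (s + 1) => ζ ^ (i : ℕ))
    (fun i j hij => Fin.ext (hζ.pow_inj i.isLt j.isLt hij)) fun i => h _ ?_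
  rw [← pow_mul, mul_comm, pow_mul, hζ.pow_eq_one, one_pow]

/-- (Theorem 3.1) Invertibility of the Strang-type block-circulant
preconditioner `S = s(A) ⊗ I_N − h s(B) ⊗ J`: if `ρ(z) − hλσ(z) ≠ 0` for every
eigenvalue `λ` of `J` and every `(s+1)`-st root of unity `z`, then `S` is
invertible. -/
theorem stmt16 (μ ν s N : ℕ) (hμ : 1 ≤ μ) (hν : ν ≤ μ) (hs : μ ≤ s) (hN : 1 ≤ N)
    (a b : ℕ → ℝ) (J : Matrix (Fin N) (Fin N) ℂ) (h : ℝ) (hh : 0 < h)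
    (S : Matrix (Fin (s + 1) × Fin N) (Fin (s + 1) × Fin N) ℂ)
    (hS : S = (Matrix.circulant (strangCol a μ ν s)).map Complex.ofReal
            ⊗ₖ (1 : Matrix (Fin N) (Fin N) ℂ) -
          (h : ℂ) • ((Matrix.circulant (strangCol b μ ν s)).map Complex.ofReal ⊗ₖ J))
    (hroot : ∀ lam ∈ spectrum ℂ J, ∀ z : ℂ, z ^ (s + 1) = 1 →
      (∑ j ∈ Finset.range (μ + 1), (a j : ℂ) * z ^ j) -
        (h : ℂ) * lam * (∑ j ∈ Finset.range (μ + 1), (b j : ℂ) * z ^ j) ≠ 0) :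
    IsUnit S := by
  refine mulVec_injective_iff_isUnit.mp
    ((injective_iff_map_eq_zero (mulVecLin S)).mpr fun x hx => ?_)
  rw [mulVecLin_apply] at hx
  have hfourier (z : ℂ) (hz : z ^ (s + 1) = 1) :
      (fun l => ∑ j : Fin (s + 1), x (j, l) * z ^ (j : ℕ)) = 0 := by
    have hz0 : z ≠ 0 := by
      rintro rfl
      simp at hz
    have hzw : z * z⁻¹ = 1 := mul_inv_cancel₀ hz0
    refine eq_zero_of_smul_eq_smul_mulVec (J := J)
      (p := ∑ j ∈ Finset.range (μ + 1), (a j : ℂ) * z⁻¹ ^ j)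
      (q := h * ∑ j ∈ Finset.range (μ + 1), (b j : ℂ) * z⁻¹ ^ j) (fun l hl => ?_) ?_
    · convert hroot l hl z⁻¹ (by rw [inv_pow, hz, inv_one]) using 2
      ring
    · funext k
      have hsum : ∑ i : Fin (s + 1), z ^ (i : ℕ) * (S *ᵥ x) (i, k) = 0 := by simp [hx]
      simp only [hS, map_circulant, sub_mulVec, smul_mulVec, Pi.sub_apply, Pi.smul_apply,
        smul_eq_mul, mul_sub, Finset.sum_sub_distrib, mul_left_comm _ (h : ℂ),
        ← Finset.mul_sum] at hsum
      rw [sum_pow_mul_circulant_kronecker_mulVec hz, sum_pow_mul_circulant_kronecker_mulVec hz,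
        sum_strangCol_mul_pow hν hs a hz hzw, sum_strangCol_mul_pow hν hs b hz hzw,
        one_mulVec] at hsum
      refine mul_left_cancel₀ (pow_ne_zero ν hz0) ?_
      simp only [Pi.smul_apply, smul_eq_mul]
      linear_combination hsum
  funext ⟨j, l⟩
  exact congrFun (eq_zero_of_sum_mul_pow_eq_zero (fun j => x (j, l))
    fun z hz => congrFun (hfourier z hz) l) j
end
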